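/- Let n ≥ 4 be an integer and p a prime. The degree of the diagonal matrix diag(p, p, p², …, p², p³, p³) (with n−4 entries equal to p²) equals p⁴·(p^{n−3}−1)·(p^{n−2}−1)·(p^{n−1}−1)·(p^n−1)/((p−1)²·(p²−1)²). -/

import Mathlib

open Matrix

/-- `Λ_n = GL_n(ℤ)` viewed inside the `n × n` rational matrices: the matrices with integer
entries whose determinant is `±1`. -/
def Lambda (n : ℕ) : Set (Matrix (Fin n) (Fin n) ℚ) :=
  {γ | (∀ i j, ∃ z : ℤ, γ i j = (z : ℚ)) ∧ (γ.det = 1 ∨ γ.det = -1)}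

/-- The right coset `Λ_n h = {γ * h : γ ∈ Λ_n}`. -/
def rightCoset (n : ℕ) (h : Matrix (Fin n) (Fin n) ℚ) : Set (Matrix (Fin n) (Fin n) ℚ) :=
  {m | ∃ γ ∈ Lambda n, m = γ * h}

/-- The double coset `Λ_n g Λ_n = {γ₁ * g * γ₂ : γ₁, γ₂ ∈ Λ_n}`. -/
def doubleCoset (n : ℕ) (g : Matrix (Fin n) (Fin n) ℚ) : Set (Matrix (Fin n) (Fin n) ℚ) :=
  {m | ∃ γ₁ ∈ Lambda n, ∃ γ₂ ∈ Lambda n, m = γ₁ * g * γ₂}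

/-- The degree of `g`: the number of distinct right cosets `Λ_n h` contained in `Λ_n g Λ_n`. -/
noncomputable def degree (n : ℕ) (g : Matrix (Fin n) (Fin n) ℚ) : ℕ :=
  Set.ncard {S : Set (Matrix (Fin n) (Fin n) ℚ) | ∃ h ∈ doubleCoset n g, S = rightCoset n h}

/-- The `k`-th determinantal divisor of an `n × n` integer matrix: the gcd of all of its
`k × k` minors (which is `0` when all these minors vanish), a minor being indexed by a pair
of strictly increasing maps `Fin k → Fin n` selecting rows and columns. -/
def detDiv (n k : ℕ) (C : Matrix (Fin n) (Fin n) ℤ) : ℤ :=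
  Finset.gcd ((Finset.univ : Finset ((Fin k → Fin n) × (Fin k → Fin n))).filter
      (fun fg => (∀ a b : Fin k, a < b → fg.1 a < fg.1 b) ∧
        (∀ a b : Fin k, a < b → fg.2 a < fg.2 b)))
    (fun fg => (C.submatrix fg.1 fg.2).det)

/-- `D^(n)(p) = diag(1, p, …, p, p²)` with `n - 2` middle diagonal entries equal to `p`. -/
def Dmat (n p : ℕ) : Matrix (Fin n) (Fin n) ℤ :=
  Matrix.diagonal (fun i => if i.val = 0 then 1 else if i.val = n - 1 then (p : ℤ) ^ 2 else (p : ℤ))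

/-- The set `R₀^(n)(p)` of upper-triangular integer matrices whose determinantal divisors are
`d_k = p^(k-1)` for `1 ≤ k ≤ n - 1` and `d_n = p^n`, whose diagonal entries all equal `p`, and
whose above-diagonal entries lie in `[0, p)`. -/
def R0 (n p : ℕ) : Set (Matrix (Fin n) (Fin n) ℤ) :=
  {C | (∀ i j : Fin n, j < i → C i j = 0) ∧
    (∀ k : ℕ, 1 ≤ k → k ≤ n - 1 → detDiv n k C = (p : ℤ) ^ (k - 1)) ∧
    detDiv n n C = (p : ℤ) ^ n ∧
    (∀ i : Fin n, C i i = (p : ℤ)) ∧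
    (∀ i j : Fin n, i < j → 0 ≤ C i j ∧ C i j < (p : ℤ))}

/-- The set `R₁^(n)(p)` of upper-triangular integer matrices whose diagonal entries lie in
`{1, p, p²}` with exactly one entry `1` and exactly one entry `p²`, whose above-diagonal
entries satisfy `0 ≤ c i j < c j j`, and such that `p ∣ c i i` implies `p ∣ c i j` for `j > i`. -/
def R1 (n p : ℕ) : Set (Matrix (Fin n) (Fin n) ℤ) :=
  {C | (∀ i j : Fin n, j < i → C i j = 0) ∧
    (∀ i : Fin n, C i i = 1 ∨ C i i = (p : ℤ) ∨ C i i = (p : ℤ) ^ 2) ∧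
    (∃! i : Fin n, C i i = 1) ∧
    (∃! i : Fin n, C i i = (p : ℤ) ^ 2) ∧
    (∀ i j : Fin n, i < j → 0 ≤ C i j ∧ C i j < C j j) ∧
    (∀ i j : Fin n, i < j → (p : ℤ) ∣ C i i → (p : ℤ) ∣ C i j)}

/-- Casting an integer matrix to a rational matrix. -/
def toQ (n : ℕ) (C : Matrix (Fin n) (Fin n) ℤ) : Matrix (Fin n) (Fin n) ℚ :=
  C.map (fun z : ℤ => (z : ℚ))

theorem Subgroup.index_eq_card_of_transversal {G α : Type*} [Group G] (K : Subgroup G)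
    (f : α → G) (hinj : ∀ a b, (f a)⁻¹ * f b ∈ K → a = b) (hsurj : ∀ g, ∃ a, (f a)⁻¹ * g ∈ K) :
    K.index = Nat.card α := by
  refine (Nat.card_eq_of_bijective (fun a => (f a : G ⧸ K)) ⟨fun a b h => ?_, fun x => ?_⟩).symm
  · exact hinj a b (QuotientGroup.eq.1 h)
  · obtain ⟨g, rfl⟩ := QuotientGroup.mk_surjective x
    obtain ⟨a, ha⟩ := hsurj g
    exact ⟨a, QuotientGroup.eq.2 ha⟩

theorem Subgroup.ncard_range_eq_index {G α : Type*} [Group G] (K : Subgroup G) (f : G → α)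
    (h : ∀ a b, f a = f b ↔ a⁻¹ * b ∈ K) : (Set.range f).ncard = K.index := by
  rw [← Nat.card_coe_set_eq]
  refine (Nat.card_eq_of_bijective
    (fun x : G ⧸ K => Quotient.liftOn' x (fun g => (⟨f g, g, rfl⟩ : Set.range f)) ?_) ⟨?_, ?_⟩).symm
  · intro a b hab
    exact Subtype.ext ((h a b).2 (QuotientGroup.leftRel_apply.1 hab))
  · intro x y
    induction x using QuotientGroup.induction_on
    induction y using QuotientGroup.induction_on
    intro hxy
    exact QuotientGroup.eq.2 ((h _ _).1 (congrArg Subtype.val hxy))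
  · rintro ⟨_, g, rfl⟩
    exact ⟨(g : G ⧸ K), rfl⟩

section Degree

/-- The subgroup `GL ∩ D⁻¹ GL D` of integral invertible matrices `γ` for which `D γ D⁻¹` is
integral and invertible. -/
def intertwiner {ι : Type*} [Fintype ι] [DecidableEq ι] (D : Matrix ι ι ℤ) :
    Subgroup (GL ι ℤ) where
  carrier := {γ | ∃ δ : GL ι ℤ, D * (γ : Matrix ι ι ℤ) = (δ : Matrix ι ι ℤ) * D}
  mul_mem' := by
    rintro a b ⟨c, hc⟩ ⟨d, hd⟩
    refine ⟨c * d, ?_⟩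
    rw [Units.val_mul, Units.val_mul, ← mul_assoc, hc, mul_assoc, hd, mul_assoc]
  one_mem' := ⟨1, by simp⟩
  inv_mem' := by
    rintro a ⟨c, hc⟩
    refine ⟨c⁻¹, ?_⟩
    rw [Units.eq_inv_mul_iff_mul_eq, ← mul_assoc, ← hc, mul_assoc, Units.mul_inv, mul_one]

theorem mem_intertwiner {ι : Type*} [Fintype ι] [DecidableEq ι] {D : Matrix ι ι ℤ}
    {γ : GL ι ℤ} : γ ∈ intertwiner D ↔
      ∃ δ : GL ι ℤ, D * (γ : Matrix ι ι ℤ) = (δ : Matrix ι ι ℤ) * D := Iff.rfl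

theorem mem_intertwiner_diagonal {ι : Type*} [Fintype ι] [DecidableEq ι] {d : ι → ℤ}
    (hd : ∀ i, d i ≠ 0) {γ : GL ι ℤ} :
    γ ∈ intertwiner (diagonal d) ↔ ∀ i j, d j ∣ d i * (γ : Matrix ι ι ℤ) i j := by
  rw [mem_intertwiner]
  constructor
  · rintro ⟨δ, hδ⟩ i j
    have := congrFun (congrFun hδ i) j
    rw [diagonal_mul, mul_diagonal] at this
    exact ⟨_, this.trans (mul_comm _ _)⟩
  · intro h
    choose c hc using h
    have hmul : diagonal d * (γ : Matrix ι ι ℤ) = of c * diagonal d := by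
      ext i j
      rw [diagonal_mul, mul_diagonal, hc, of_apply, mul_comm]
    have hdet : (of c).det = (γ : Matrix ι ι ℤ).det := by
      have := congrArg det hmul
      rw [det_mul, det_mul, mul_comm, det_diagonal] at this
      exact (mul_right_cancel₀ (Finset.prod_ne_zero_iff.2 fun i _ => hd i) this).symm
    refine ⟨GeneralLinearGroup.mk'' (of c) ?_, hmul⟩
    rw [hdet]
    exact (isUnit_iff_isUnit_det _).1 γ.isUnit

theorem toQ_mul (n : ℕ) (A B : Matrix (Fin n) (Fin n) ℤ) : toQ n (A * B) = toQ n A * toQ n B :=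
  Matrix.map_mul (f := Int.castRingHom ℚ)

theorem toQ_injective (n : ℕ) : Function.Injective (toQ n) :=
  Matrix.map_injective Int.cast_injective

theorem toQ_one (n : ℕ) : toQ n 1 = 1 :=
  Matrix.map_one _ Int.cast_zero Int.cast_one

theorem det_toQ (n : ℕ) (A : Matrix (Fin n) (Fin n) ℤ) : (toQ n A).det = (A.det : ℚ) :=
  ((Int.castRingHom ℚ).map_det A).symm

theorem mem_Lambda_iff {n : ℕ} {γ : Matrix (Fin n) (Fin n) ℚ} :
    γ ∈ Lambda n ↔ ∃ δ : GL (Fin n) ℤ, γ = toQ n δ := by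
  constructor
  · rintro ⟨hint, hdet⟩
    choose c hc using hint
    have hγ : γ = toQ n (of c) := by
      ext i j
      exact hc i j
    rw [hγ, det_toQ] at hdet
    refine ⟨GeneralLinearGroup.mk'' (of c) (Int.isUnit_iff.2 ?_), hγ⟩
    exact_mod_cast hdet
  · rintro ⟨δ, rfl⟩
    refine ⟨fun i j => ⟨_, rfl⟩, ?_⟩
    rw [det_toQ]
    exact_mod_cast Int.isUnit_iff.1 ((isUnit_iff_isUnit_det _).1 δ.isUnit)

theorem rightCoset_eq_rightCoset_iff {n : ℕ} {h h' : Matrix (Fin n) (Fin n) ℚ} :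
    rightCoset n h = rightCoset n h' ↔ ∃ δ : GL (Fin n) ℤ, h = toQ n δ * h' := by
  constructor
  · intro H
    have : h ∈ rightCoset n h :=
      ⟨1, mem_Lambda_iff.2 ⟨1, (toQ_one n).symm⟩, (one_mul h).symm⟩
    rw [H] at this
    obtain ⟨γ, hγ, e⟩ := this
    obtain ⟨δ, rfl⟩ := mem_Lambda_iff.1 hγ
    exact ⟨δ, e⟩
  · rintro ⟨δ, rfl⟩
    ext m
    constructor
    · rintro ⟨γ, hγ, rfl⟩
      obtain ⟨ε, rfl⟩ := mem_Lambda_iff.1 hγ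
      exact ⟨toQ n (ε * δ : GL (Fin n) ℤ), mem_Lambda_iff.2 ⟨_, rfl⟩, by
        rw [Units.val_mul, toQ_mul, mul_assoc]⟩
    · rintro ⟨γ, hγ, rfl⟩
      obtain ⟨ε, rfl⟩ := mem_Lambda_iff.1 hγ
      refine ⟨toQ n (ε * δ⁻¹ : GL (Fin n) ℤ), mem_Lambda_iff.2 ⟨_, rfl⟩, ?_⟩
      rw [← mul_assoc, ← toQ_mul, ← Units.val_mul, inv_mul_cancel_right]

theorem degree_toQ (n : ℕ) (D : Matrix (Fin n) (Fin n) ℤ) :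
    degree n (toQ n D) = (intertwiner D).index := by
  rw [← Subgroup.ncard_range_eq_index (intertwiner D)
    (fun γ => rightCoset n (toQ n (D * (γ⁻¹ : GL (Fin n) ℤ)))), degree]
  · congr 1
    ext S
    constructor
    · rintro ⟨h, ⟨γ₁, h₁, γ₂, h₂, rfl⟩, rfl⟩
      obtain ⟨δ₁, rfl⟩ := mem_Lambda_iff.1 h₁
      obtain ⟨δ₂, rfl⟩ := mem_Lambda_iff.1 h₂
      refine ⟨δ₂⁻¹, rightCoset_eq_rightCoset_iff.2 ⟨δ₁⁻¹, ?_⟩⟩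
      rw [inv_inv, ← toQ_mul, ← toQ_mul, ← toQ_mul, mul_assoc, Units.inv_mul_cancel_left]
    · rintro ⟨γ, rfl⟩
      refine ⟨_, ⟨1, mem_Lambda_iff.2 ⟨1, (toQ_one n).symm⟩, _,
        mem_Lambda_iff.2 ⟨γ⁻¹, rfl⟩, rfl⟩, ?_⟩
      rw [one_mul, ← toQ_mul]
  · intro a b
    rw [rightCoset_eq_rightCoset_iff, mem_intertwiner]
    refine exists_congr fun δ => ?_
    rw [← toQ_mul, (toQ_injective n).eq_iff, Units.val_mul, ← mul_assoc, ← mul_assoc,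
      Units.eq_mul_inv_iff_mul_eq]

end Degree
section Parabolic

variable {ι : Type*} [Fintype ι] [DecidableEq ι]

/-- The invertible matrices that are block lower triangular for the block labelling `b`. -/
def blockLower (R : Type*) [CommRing R] (b : ι → ℕ) : Subgroup (GL ι R) where
  carrier := {γ | BlockTriangular (γ : Matrix ι ι R) (OrderDual.toDual ∘ b)}
  mul_mem' := by
    intro x y hx hy
    exact BlockTriangular.mul hx hy
  one_mem' := blockTriangular_one
  inv_mem' := by
    intro x hx
    let _ := x.invertible
    have := blockTriangular_inv_of_blockTriangular hx
    rwa [← coe_units_inv] at this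

theorem mem_blockLower {R : Type*} [CommRing R] {b : ι → ℕ} {γ : GL ι R} :
    γ ∈ blockLower R b ↔ ∀ i j, b i < b j → (γ : Matrix ι ι R) i j = 0 := Iff.rfl

/-- Reduction modulo `p` of invertible integer matrices. -/
noncomputable def reduction (ι : Type*) [Fintype ι] [DecidableEq ι] (p : ℕ) :
    GL ι ℤ →* GL ι (ZMod p) :=
  GeneralLinearGroup.map (Int.castRingHom (ZMod p))

theorem coe_reduction (p : ℕ) (γ : GL ι ℤ) :
    (reduction ι p γ : Matrix ι ι (ZMod p)) =
      (γ : Matrix ι ι ℤ).map (Int.castRingHom (ZMod p)) := rfl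

theorem mem_comap_reduction_blockLower {p : ℕ} {b : ι → ℕ} {γ : GL ι ℤ} :
    γ ∈ (blockLower (ZMod p) b).comap (reduction ι p) ↔
      ∀ i j, b i < b j → (p : ℤ) ∣ (γ : Matrix ι ι ℤ) i j := by
  rw [Subgroup.mem_comap, mem_blockLower]
  simp only [coe_reduction, map_apply, eq_intCast, ZMod.intCast_zmod_eq_zero_iff_dvd]

theorem exists_reduction_eq_transvection {p : ℕ} (t : TransvectionStruct ι (ZMod p)) :
    ∃ γ : GL ι ℤ, (reduction ι p γ : Matrix ι ι (ZMod p)) = t.toMatrix := by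
  obtain ⟨i, j, hij, c⟩ := t
  obtain ⟨z, rfl⟩ := ZMod.intCast_surjective c
  let s : TransvectionStruct ι ℤ := ⟨i, j, hij, z⟩
  refine ⟨⟨s.toMatrix, s.inv.toMatrix, s.mul_inv, s.inv_mul⟩, ?_⟩
  rw [coe_reduction]
  ext k l
  simp only [s, TransvectionStruct.toMatrix_mk, transvection, map_apply, Matrix.add_apply,
    map_add, one_apply, single_apply]
  split_ifs <;> simp

theorem exists_reduction_eq_prod_transvection {p : ℕ} (L : List (TransvectionStruct ι (ZMod p))) :
    ∃ γ : GL ι ℤ,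
      (reduction ι p γ : Matrix ι ι (ZMod p)) = (L.map TransvectionStruct.toMatrix).prod := by
  induction L with
  | nil => exact ⟨1, by simp⟩
  | cons t L ih =>
    obtain ⟨γ, hγ⟩ := ih
    obtain ⟨δ, hδ⟩ := exists_reduction_eq_transvection t
    exact ⟨δ * γ, by rw [map_mul, Units.val_mul, hγ, hδ, List.map_cons, List.prod_cons]⟩

theorem exists_diagonal_mul_prod_transvection {F : Type*} [Field F] {d : ι → F}
    (hd : ∀ i, d i ≠ 0) (L : List (TransvectionStruct ι F)) :
    ∃ L' : List (TransvectionStruct ι F),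
      diagonal d * (L.map TransvectionStruct.toMatrix).prod =
        (L'.map TransvectionStruct.toMatrix).prod * diagonal d := by
  induction L with
  | nil => exact ⟨[], by simp⟩
  | cons t L ih =>
    obtain ⟨L', hL'⟩ := ih
    obtain ⟨i, j, hij, c⟩ := t
    have key : diagonal d * transvection i j c =
        transvection i j (d i * c * (d j)⁻¹) * diagonal d := by
      ext k l
      by_cases hk : i = k <;> by_cases hl : j = l <;>
        simp [transvection, diagonal_mul, mul_diagonal, one_apply, hk, hl,
          add_mul, mul_add] <;> grind
    refine ⟨⟨i, j, hij, d i * c * (d j)⁻¹⟩ :: L', ?_⟩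
    simp only [List.map_cons, List.prod_cons, TransvectionStruct.toMatrix_mk]
    rw [← mul_assoc, key, mul_assoc, hL', ← mul_assoc]

theorem exists_reduction_mul_diagonal {p : ℕ} [Fact p.Prime] (M : GL ι (ZMod p)) :
    ∃ (γ : GL ι ℤ) (d : ι → ZMod p),
      (M : Matrix ι ι (ZMod p)) = (reduction ι p γ : Matrix ι ι (ZMod p)) * diagonal d := by
  obtain ⟨L₁, L₂, d, h⟩ :=
    Pivot.exists_list_transvec_mul_diagonal_mul_list_transvec (M : Matrix ι ι (ZMod p))
  have hd : ∀ i, d i ≠ 0 := by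
    have := congrArg det h
    rw [det_mul, det_mul, TransvectionStruct.det_toMatrix_prod,
      TransvectionStruct.det_toMatrix_prod, one_mul, mul_one, det_diagonal] at this
    have hu := ((isUnit_iff_isUnit_det _).1 M.isUnit).ne_zero
    rw [this] at hu
    exact fun i => Finset.prod_ne_zero_iff.1 hu i (Finset.mem_univ i)
  obtain ⟨L₃, h₃⟩ := exists_diagonal_mul_prod_transvection hd L₂
  obtain ⟨γ₁, h₁⟩ := exists_reduction_eq_prod_transvection L₁
  obtain ⟨γ₂, h₂⟩ := exists_reduction_eq_prod_transvection L₃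
  refine ⟨γ₁ * γ₂, d, ?_⟩
  rw [h, mul_assoc, h₃, ← h₁, ← h₂, map_mul, Units.val_mul, mul_assoc]

theorem index_comap_reduction_blockLower (p : ℕ) [Fact p.Prime] (b : ι → ℕ) :
    ((blockLower (ZMod p) b).comap (reduction ι p)).index = (blockLower (ZMod p) b).index := by
  rw [← Subgroup.ncard_range_eq_index _
    (fun γ => (reduction ι p γ : GL ι (ZMod p) ⧸ blockLower (ZMod p) b))]
  · rw [Subgroup.index, ← Set.ncard_univ]
    congr 1
    refine Set.eq_univ_of_forall fun x => ?_
    obtain ⟨M, rfl⟩ := QuotientGroup.mk_surjective x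
    obtain ⟨γ, d, h⟩ := exists_reduction_mul_diagonal M
    refine ⟨γ, QuotientGroup.eq.2 (mem_blockLower.2 fun i j hij => ?_)⟩
    rw [Units.val_mul, h, Units.inv_mul_cancel_left, diagonal_apply_ne]
    rintro rfl
    exact hij.false
  · intro a c
    rw [QuotientGroup.eq, Subgroup.mem_comap, map_mul, map_inv]

end Parabolic

section Transversal

variable {ι : Type*} [Fintype ι] [DecidableEq ι]

/-- The integer matrix with least nonnegative entries that lifts `E`, placed in the rows of label
`0` and the columns of label `2`. -/
def cornerLift {p : ℕ} (b : ι → ℕ) (E : {i // b i = 0} → {j // b j = 2} → ZMod p) :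
    Matrix ι ι ℤ :=
  of fun i j => if h : b i = 0 ∧ b j = 2 then ((E ⟨i, h.1⟩ ⟨j, h.2⟩).val : ℤ) else 0

omit [DecidableEq ι] in
theorem cornerLift_mul_cornerLift {p : ℕ} (b : ι → ℕ)
    (E E' : {i // b i = 0} → {j // b j = 2} → ZMod p) :
    cornerLift b E * cornerLift b E' = 0 := by
  ext i j
  rw [mul_apply, Matrix.zero_apply]
  refine Finset.sum_eq_zero fun k _ => ?_
  by_cases hk : b k = 0 <;> simp [cornerLift, hk]

theorem one_sub_smul_cornerLift_mul_one_add {p : ℕ} (b : ι → ℕ)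
    (E E' : {i // b i = 0} → {j // b j = 2} → ZMod p) :
    (1 - (p : ℤ) • cornerLift b E) * (1 + (p : ℤ) • cornerLift b E') =
      1 + (p : ℤ) • (cornerLift b E' - cornerLift b E) := by
  rw [sub_mul, one_mul, mul_add, mul_one, smul_mul_smul_comm, cornerLift_mul_cornerLift,
    smul_zero, add_zero, smul_sub]
  abel

/-- The unipotent matrix `1 + p N` where `N` is the corner lift of `E`. -/
def cornerUnipotent {p : ℕ} (b : ι → ℕ) (E : {i // b i = 0} → {j // b j = 2} → ZMod p) :
    GL ι ℤ where
  val := 1 + (p : ℤ) • cornerLift b E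
  inv := 1 - (p : ℤ) • cornerLift b E
  val_inv := by
    rw [add_mul, one_mul, mul_sub, mul_one, smul_mul_smul_comm, cornerLift_mul_cornerLift,
      smul_zero, sub_zero, sub_add_cancel]
  inv_val := by
    rw [one_sub_smul_cornerLift_mul_one_add, sub_self, smul_zero, add_zero]

theorem coe_cornerUnipotent {p : ℕ} (b : ι → ℕ)
    (E : {i // b i = 0} → {j // b j = 2} → ZMod p) :
    (cornerUnipotent b E : Matrix ι ι ℤ) = 1 + (p : ℤ) • cornerLift b E := rfl

theorem coe_inv_cornerUnipotent {p : ℕ} (b : ι → ℕ)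
    (E : {i // b i = 0} → {j // b j = 2} → ZMod p) :
    ((cornerUnipotent b E)⁻¹ : GL ι ℤ).val = 1 - (p : ℤ) • cornerLift b E := rfl

theorem cornerUnipotent_mem {p : ℕ} (b : ι → ℕ)
    (E : {i // b i = 0} → {j // b j = 2} → ZMod p) :
    cornerUnipotent b E ∈ (blockLower (ZMod p) b).comap (reduction ι p) := by
  rw [mem_comap_reduction_blockLower]
  intro i j hij
  have hne : i ≠ j := by
    rintro rfl
    exact hij.false
  rw [coe_cornerUnipotent, Matrix.add_apply, one_apply_ne hne, zero_add, Matrix.smul_apply,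
    smul_eq_mul]
  exact dvd_mul_right _ _

theorem mem_intertwiner_iff_of_le_two {p : ℕ} (hp : p ≠ 0) {b : ι → ℕ} (hb : ∀ i, b i ≤ 2)
    {γ : GL ι ℤ} : γ ∈ intertwiner (diagonal fun i => (p : ℤ) ^ (b i + 1)) ↔
      γ ∈ (blockLower (ZMod p) b).comap (reduction ι p) ∧
        ∀ i j, b i = 0 → b j = 2 → (p : ℤ) ^ 2 ∣ (γ : Matrix ι ι ℤ) i j := by
  have hp' : (p : ℤ) ≠ 0 := by exact_mod_cast hp
  rw [mem_intertwiner_diagonal fun i => pow_ne_zero _ hp', mem_comap_reduction_blockLower]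
  have key : ∀ i j, b i ≤ b j → ((p : ℤ) ^ (b j + 1) ∣ (p : ℤ) ^ (b i + 1) * γ.val i j ↔
      (p : ℤ) ^ (b j - b i) ∣ γ.val i j) := fun i j hij => by
    rw [show b j + 1 = (b i + 1) + (b j - b i) by lia, pow_add,
      mul_dvd_mul_iff_left (pow_ne_zero _ hp')]
  constructor
  · intro h
    refine ⟨fun i j hij => ?_, fun i j hi hj => ?_⟩
    · exact (dvd_pow_self _ (by lia)).trans ((key i j hij.le).1 (h i j))
    · simpa [hi, hj] using (key i j (by lia)).1 (h i j)
  · rintro ⟨h₁, h₂⟩ i j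
    rcases le_or_gt (b j) (b i) with hij | hij
    · exact (pow_dvd_pow _ (by lia)).mul_right _
    · rw [key i j hij.le]
      have := hb j
      obtain h | h : b j - b i = 1 ∨ b i = 0 ∧ b j = 2 := by lia
      · rw [h, pow_one]
        exact h₁ i j hij
      · rw [h.1, h.2]
        exact h₂ i j h.1 h.2

theorem exists_inv_cornerUnipotent_mul_mem {p : ℕ} [NeZero p] {b : ι → ℕ} {γ : GL ι ℤ}
    (hb : ∀ i, b i ≤ 2) (hγ : γ ∈ (blockLower (ZMod p) b).comap (reduction ι p)) :
    ∃ E : {i // b i = 0} → {j // b j = 2} → ZMod p,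
      ∀ i j, b i = 0 → b j = 2 →
        (p : ℤ) ^ 2 ∣ ((cornerUnipotent b E)⁻¹ * γ : GL ι ℤ).val i j := by
  rw [mem_comap_reduction_blockLower] at hγ
  choose! q hq using hγ
  set M : Matrix ι ι ℤ := γ.val with hM
  set V : Matrix ι ι ℤ := (γ⁻¹ : GL ι ℤ).val with hV
  have hVM : V * M = 1 := Units.inv_mul γ
  let e : Matrix ι ι ℤ := diagonal fun i => if b i = 2 then 1 else 0
  let X : Matrix ι ι ℤ := of fun i j => if b i = 0 ∧ b j = 2 then q i j else 0
  let Y : Matrix ι ι ℤ := of fun i j => if b i < 2 ∧ b j = 2 then q i j else 0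
  let E : {i // b i = 0} → {j // b j = 2} → ZMod p := fun i j => ((X * V) i j : ℤ)
  have hX : X * e = X := by
    ext i j
    by_cases hj : b j = 2 <;> simp [X, e, mul_diagonal, hj]
  have hY : e * (M * e) = M * e - (p : ℤ) • Y := by
    ext i j
    have := hb i
    by_cases hj : b j = 2
    · by_cases hi : b i = 2
      · simp [e, Y, diagonal_mul, mul_diagonal, hi, hj]
      · have hle : b i ≤ 1 := by lia
        simp [-zsmul_eq_mul, e, Y, diagonal_mul, mul_diagonal, hi, hj, hle, hq i j (by lia)]
    · simp [e, Y, diagonal_mul, mul_diagonal, hj]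
  have hZ : ∀ i j, ∃ z : ℤ, cornerLift b E i j = (X * V * e) i j + p * z := by
    intro i j
    by_cases hj : b j = 2
    · by_cases hi : b i = 0
      · refine ⟨-((X * V) i j / p), ?_⟩
        have := Int.emod_add_mul_ediv ((X * V) i j) p
        simp only [cornerLift, of_apply, hi, hj, and_self, dite_true, E, ZMod.val_intCast, e,
          mul_diagonal, if_true]
        linarith
      · refine ⟨0, ?_⟩
        simp [cornerLift, hi, e, hj, mul_apply, X]
    · exact ⟨0, by simp [cornerLift, hj, e, mul_diagonal]⟩
  choose Z hZ using hZ
  have hN : cornerLift b E = X * V * e + (p : ℤ) • of Z := by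
    ext i j
    simp [hZ]
  have hmain : X - cornerLift b E * (M * e) = (p : ℤ) • (X * V * Y - of Z * (M * e)) := by
    have h1 : X * V * e * (M * e) = X - (p : ℤ) • (X * V * Y) := by
      rw [mul_assoc (X * V), hY, mul_sub, mul_smul_comm, mul_assoc X V (M * e), ← mul_assoc V,
        hVM, one_mul, hX]
    rw [hN, add_mul, h1, smul_mul_assoc, smul_sub]
    abel
  refine ⟨E, fun i j hi hj => ?_⟩
  have hij := congrFun (congrFun hmain i) j
  have hcol : (cornerLift b E * (M * e)) i j = (cornerLift b E * M) i j := by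
    rw [← mul_assoc]
    simp [e, mul_diagonal, hj]
  rw [Matrix.sub_apply, hcol, Matrix.smul_apply, smul_eq_mul] at hij
  have hXij : X i j = q i j := by simp [X, hi, hj]
  rw [Units.val_mul, coe_inv_cornerUnipotent, sub_mul, one_mul, Matrix.sub_apply, smul_mul_assoc,
    Matrix.smul_apply, smul_eq_mul, ← hM, hq i j (by lia), ← hXij, ← mul_sub, hij, ← mul_assoc, ← sq]
  exact dvd_mul_right _ _

theorem relIndex_intertwiner {p : ℕ} [NeZero p] {b : ι → ℕ} (hb : ∀ i, b i ≤ 2) :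
    (intertwiner (diagonal fun i => (p : ℤ) ^ (b i + 1))).relIndex
      ((blockLower (ZMod p) b).comap (reduction ι p)) =
      p ^ (Nat.card {i // b i = 0} * Nat.card {j // b j = 2}) := by
  have hp : (p : ℤ) ≠ 0 := by exact_mod_cast NeZero.ne p
  rw [Subgroup.relIndex, Subgroup.index_eq_card_of_transversal
    (α := {i // b i = 0} → {j // b j = 2} → ZMod p) _
    (fun E => ⟨cornerUnipotent b E, cornerUnipotent_mem b E⟩)]
  · simp [← pow_mul, mul_comm]
  · intro E E' h
    rw [Subgroup.mem_subgroupOf, mem_intertwiner_iff_of_le_two (NeZero.ne p) hb] at h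
    ext i j
    have hdvd := h.2 i j i.2 j.2
    have hne : (i : ι) ≠ j := by
      intro hij
      have := i.2
      rw [hij, j.2] at this
      contradiction
    have hval : ((cornerUnipotent b E)⁻¹ * cornerUnipotent b E' : GL ι ℤ).val i j =
        p * ((E' i j).val - (E i j).val) := by
      rw [Units.val_mul, coe_inv_cornerUnipotent, coe_cornerUnipotent,
        one_sub_smul_cornerLift_mul_one_add]
      simp [-zsmul_eq_mul, cornerLift, one_apply_ne hne, i.2, j.2]
    change (p : ℤ) ^ 2 ∣ ((cornerUnipotent b E)⁻¹ * cornerUnipotent b E' : GL ι ℤ).val i j at hdvd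
    rw [hval, sq, mul_dvd_mul_iff_left hp, ← ZMod.intCast_zmod_eq_zero_iff_dvd] at hdvd
    push_cast [ZMod.natCast_zmod_val] at hdvd
    exact (sub_eq_zero.1 hdvd).symm
  · rintro ⟨γ, hγ⟩
    obtain ⟨E, hE⟩ := exists_inv_cornerUnipotent_mul_mem hb hγ
    refine ⟨E, ?_⟩
    rw [Subgroup.mem_subgroupOf, mem_intertwiner_iff_of_le_two (NeZero.ne p) hb]
    exact ⟨mul_mem (inv_mem (cornerUnipotent_mem b E)) hγ, hE⟩

end Transversal
section Counting

/-- The block lower triangular matrices whose diagonal blocks lie in `S` and `T`. -/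
def blockSet {A B F : Type*} [Zero F] (S : Set (Matrix A A F)) (T : Set (Matrix B B F)) :
    Set (Matrix (A ⊕ B) (A ⊕ B) F) :=
  {M | M.toBlocks₁₂ = 0 ∧ M.toBlocks₁₁ ∈ S ∧ M.toBlocks₂₂ ∈ T}

theorem ncard_blockSet {A B F : Type*} [Fintype A] [Fintype B] [Zero F]
    (S : Set (Matrix A A F)) (T : Set (Matrix B B F)) :
    (blockSet S T).ncard =
      S.ncard * T.ncard * Nat.card F ^ (Fintype.card A * Fintype.card B) := by
  let f : (Matrix A A F × Matrix B B F) × Matrix B A F → Matrix (A ⊕ B) (A ⊕ B) F :=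
    fun x => fromBlocks x.1.1 0 x.2 x.1.2
  have hf : Function.Injective f := by
    rintro ⟨⟨a, d⟩, c⟩ ⟨⟨a', d'⟩, c'⟩ h
    obtain ⟨h₁, -, h₃, h₄⟩ := fromBlocks_inj.1 h
    dsimp only at h₁ h₃ h₄
    rw [h₁, h₃, h₄]
  have himage : blockSet S T = f '' ((S ×ˢ T) ×ˢ Set.univ) := by
    ext M
    constructor
    · rintro ⟨h₁₂, h₁₁, h₂₂⟩
      refine ⟨((M.toBlocks₁₁, M.toBlocks₂₂), M.toBlocks₂₁), ⟨⟨h₁₁, h₂₂⟩, trivial⟩, ?_⟩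
      conv_rhs => rw [← fromBlocks_toBlocks M, h₁₂]
    · rintro ⟨⟨⟨a, d⟩, c⟩, ⟨⟨ha, hd⟩, -⟩, rfl⟩
      simpa [f, blockSet] using And.intro ha hd
  rw [himage, Set.ncard_image_of_injective _ hf, Set.ncard_prod, Set.ncard_prod, Set.ncard_univ]
  congr 1
  simp [Matrix, Nat.card_fun, ← pow_mul]

theorem natCard_GL_eq_ncard (ι F : Type*) [Fintype ι] [DecidableEq ι] [Field F] :
    Nat.card (GL ι F) = {M : Matrix ι ι F | M.det ≠ 0}.ncard := by
  rw [← Set.ncard_univ, ← Set.ncard_image_of_injective _ (Units.val_injective), Set.image_univ]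
  congr 1
  ext M
  rw [Set.mem_range, Set.mem_ofPred_eq, ← isUnit_iff_ne_zero, ← isUnit_iff_isUnit_det]
  rfl

theorem natCard_blockLower {ι A B C F : Type*} [Fintype ι] [DecidableEq ι] [Fintype A]
    [DecidableEq A] [Fintype B] [DecidableEq B] [Fintype C] [DecidableEq C] [Field F]
    {b : ι → ℕ} (e : ι ≃ A ⊕ B ⊕ C) (hA : ∀ a, b (e.symm (.inl a)) = 0)
    (hB : ∀ a, b (e.symm (.inr (.inl a))) = 1) (hC : ∀ a, b (e.symm (.inr (.inr a))) = 2) :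
    Nat.card (blockLower F b) =
      Nat.card (GL A F) * (Nat.card (GL B F) * Nat.card (GL C F) *
        Nat.card F ^ (Fintype.card B * Fintype.card C)) *
        Nat.card F ^ (Fintype.card A * (Fintype.card B + Fintype.card C)) := by
  rw [natCard_GL_eq_ncard, natCard_GL_eq_ncard, natCard_GL_eq_ncard, ← ncard_blockSet,
    ← Fintype.card_sum, ← ncard_blockSet, ← SetLike.coe_sort_coe, Nat.card_coe_set_eq,
    ← Set.ncard_image_of_injective _ ((reindex e e).injective.comp Units.val_injective)]
  congr 1
  ext M
  constructor
  · rintro ⟨γ, hγ, rfl⟩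
    have hγ : ∀ i j, b i < b j → γ.val i j = 0 := hγ
    have h₁ : (reindex e e γ.val).toBlocks₁₂ = 0 := by
      ext i j
      refine hγ _ _ ?_
      rw [hA]
      rcases j with j | j
      · rw [hB]; exact one_pos
      · rw [hC]; exact two_pos
    have h₂ : (reindex e e γ.val).toBlocks₂₂.toBlocks₁₂ = 0 := by
      ext i j
      refine hγ _ _ ?_
      rw [hB, hC]
      exact one_lt_two
    have hdet : (reindex e e γ.val).det ≠ 0 := by
      rw [det_reindex_self]
      exact ((isUnit_iff_isUnit_det _).1 γ.isUnit).ne_zero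
    rw [← fromBlocks_toBlocks (reindex e e γ.val), h₁, det_fromBlocks_zero₁₂,
      ← fromBlocks_toBlocks (reindex e e γ.val).toBlocks₂₂, h₂, det_fromBlocks_zero₁₂,
      mul_ne_zero_iff, mul_ne_zero_iff] at hdet
    exact ⟨h₁, hdet.1, h₂, hdet.2.1, hdet.2.2⟩
  · rintro ⟨h₁, d₁, h₂, d₂, d₃⟩
    have hdet : ((reindex e e).symm M).det ≠ 0 := by
      rw [reindex_symm, det_reindex_self, ← fromBlocks_toBlocks M, h₁, det_fromBlocks_zero₁₂,
        ← fromBlocks_toBlocks M.toBlocks₂₂, h₂, det_fromBlocks_zero₁₂]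
      exact mul_ne_zero d₁ (mul_ne_zero d₂ d₃)
    refine ⟨GeneralLinearGroup.mkOfDetNeZero _ hdet, mem_blockLower.2 fun i j hij => ?_,
      (reindex e e).apply_symm_apply M⟩
    change M (e i) (e j) = 0
    obtain ⟨x, rfl⟩ := e.symm.surjective i
    obtain ⟨y, rfl⟩ := e.symm.surjective j
    rw [e.apply_symm_apply, e.apply_symm_apply]
    rcases x with x | x | x <;> rcases y with y | y | y <;>
      simp only [hA, hB, hC] at hij <;> try lia
    · exact congrFun (congrFun h₁ x) (.inl y)
    · exact congrFun (congrFun h₁ x) (.inr y)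
    · exact congrFun (congrFun h₂ x) y

end Counting

section Formula

theorem natCard_GL_fin_add_four (p m : ℕ) [Fact p.Prime] :
    (Nat.card (GL (Fin (m + 4)) (ZMod p)) : ℚ) =
      ((p : ℚ) ^ (m + 4) - 1) * ((p : ℚ) ^ (m + 4) - p) * ((p : ℚ) ^ (m + 4) - p ^ 2) *
        ((p : ℚ) ^ (m + 4) - p ^ 3) * (p ^ (4 * m) * Nat.card (GL (Fin m) (ZMod p))) := by
  have hcast : ∀ n : ℕ, (Nat.card (GL (Fin n) (ZMod p)) : ℚ) =
      ∏ i ∈ Finset.range n, ((p : ℚ) ^ n - p ^ i) := fun n => by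
    rw [card_GL_field, ZMod.card, Finset.prod_range, Nat.cast_prod]
    refine Finset.prod_congr rfl fun i _ => ?_
    rw [Nat.cast_sub (Nat.pow_le_pow_right (Fact.out : p.Prime).pos i.2.le), Nat.cast_pow,
      Nat.cast_pow]
  rw [hcast, hcast, add_comm m 4, Finset.prod_range_add, Finset.prod_range_succ,
    Finset.prod_range_succ, Finset.prod_range_succ, Finset.prod_range_succ, Finset.prod_range_zero,
    one_mul, pow_zero, pow_one, pow_mul, ← Finset.card_range m, ← Finset.prod_const,
    Finset.card_range, ← Finset.prod_mul_distrib]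
  congr 1
  refine Finset.prod_congr rfl fun i _ => ?_
  ring

/-- The block label of an index of `diag(p, p, p², …, p², p³, p³)`. -/
def blockLabel (n : ℕ) (i : Fin n) : ℕ :=
  if i.val ≤ 1 then 0 else if n - 2 ≤ i.val then 2 else 1

/-- The splitting of the indices into the first two, the middle ones and the last two. -/
def finSplit (m : ℕ) : Fin (m + 4) ≃ Fin 2 ⊕ Fin m ⊕ Fin 2 :=
  ((Equiv.sumCongr (Equiv.refl (Fin 2)) finSumFinEquiv).trans
    (finSumFinEquiv.trans (finCongr (by lia)))).symm

theorem blockLabel_finSplit_symm_inl (m : ℕ) (a : Fin 2) :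
    blockLabel (m + 4) ((finSplit m).symm (.inl a)) = 0 := by
  simp [blockLabel, finSplit]
  lia

theorem blockLabel_finSplit_symm_inr_inl (m : ℕ) (a : Fin m) :
    blockLabel (m + 4) ((finSplit m).symm (.inr (.inl a))) = 1 := by
  simp [blockLabel, finSplit]

theorem blockLabel_finSplit_symm_inr_inr (m : ℕ) (a : Fin 2) :
    blockLabel (m + 4) ((finSplit m).symm (.inr (.inr a))) = 2 := by
  simp [blockLabel, finSplit]

theorem natCard_blockLabel_eq_zero (m : ℕ) :
    Nat.card {i : Fin (m + 4) // blockLabel (m + 4) i = 0} = 2 := by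
  refine (Nat.card_eq_of_bijective (fun a : Fin 2 => ⟨_, blockLabel_finSplit_symm_inl m a⟩)
    ⟨fun a c h => by simpa using congrArg Subtype.val h, ?_⟩).symm.trans (Nat.card_fin 2)
  rintro ⟨i, hi⟩
  obtain ⟨x, rfl⟩ := (finSplit m).symm.surjective i
  rcases x with x | x | x
  · exact ⟨x, rfl⟩
  · simp [blockLabel_finSplit_symm_inr_inl] at hi
  · simp [blockLabel_finSplit_symm_inr_inr] at hi

theorem natCard_blockLabel_eq_two (m : ℕ) :
    Nat.card {i : Fin (m + 4) // blockLabel (m + 4) i = 2} = 2 := by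
  refine (Nat.card_eq_of_bijective (fun a : Fin 2 => ⟨_, blockLabel_finSplit_symm_inr_inr m a⟩)
    ⟨fun a c h => by simpa using congrArg Subtype.val h, ?_⟩).symm.trans (Nat.card_fin 2)
  rintro ⟨i, hi⟩
  obtain ⟨x, rfl⟩ := (finSplit m).symm.surjective i
  rcases x with x | x | x
  · simp [blockLabel_finSplit_symm_inl] at hi
  · simp [blockLabel_finSplit_symm_inr_inl] at hi
  · exact ⟨x, rfl⟩

theorem blockLabel_le_two (n : ℕ) (i : Fin n) : blockLabel n i ≤ 2 := by
  unfold blockLabel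
  split_ifs <;> lia

theorem index_blockLower_blockLabel (p m : ℕ) [Fact p.Prime] :
    ((blockLower (ZMod p) (blockLabel (m + 4))).index : ℚ) =
      ((p : ℚ) ^ (m + 1) - 1) * ((p : ℚ) ^ (m + 2) - 1) * ((p : ℚ) ^ (m + 3) - 1)
        * ((p : ℚ) ^ (m + 4) - 1) / (((p : ℚ) - 1) ^ 2 * ((p : ℚ) ^ 2 - 1) ^ 2) := by
  have hp1 : (1 : ℚ) < p := by exact_mod_cast (Fact.out : p.Prime).one_lt
  have hp0 : (p : ℚ) ≠ 0 := by positivity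
  have h1 : (p : ℚ) - 1 ≠ 0 := (sub_pos.2 hp1).ne'
  have h2 : (p : ℚ) ^ 2 - 1 ≠ 0 := (sub_pos.2 (one_lt_pow₀ hp1 two_ne_zero)).ne'
  have h := (blockLower (ZMod p) (blockLabel (m + 4))).index_mul_card
  have hG2 : (Nat.card (GL (Fin 2) (ZMod p)) : ℚ) = ((p : ℚ) ^ 2 - 1) * (p * (p - 1)) := by
    rw [card_GL_field, ZMod.card, Fin.prod_univ_two, Nat.cast_mul,
      Nat.cast_sub (Nat.pow_le_pow_right (Fact.out : p.Prime).pos (by simp)),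
      Nat.cast_sub (Nat.pow_le_pow_right (Fact.out : p.Prime).pos (by simp))]
    simp only [Nat.cast_pow, Fin.val_zero, Fin.val_one, pow_zero, pow_one, Nat.cast_one]
    ring
  rw [natCard_blockLower (finSplit m) (blockLabel_finSplit_symm_inl m)
    (blockLabel_finSplit_symm_inr_inl m) (blockLabel_finSplit_symm_inr_inr m)] at h
  have h := congrArg (Nat.cast : ℕ → ℚ) h
  rw [natCard_GL_fin_add_four] at h
  have hm : (Nat.card (GL (Fin m) (ZMod p)) : ℚ) ≠ 0 := by
    exact_mod_cast Nat.card_pos.ne'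
  simp only [Nat.cast_mul, Nat.cast_pow, hG2, Nat.card_zmod, Fintype.card_fin] at h
  rw [eq_div_iff (by positivity)]
  refine mul_right_cancel₀ (mul_ne_zero (pow_ne_zero (4 * m + 6) hp0) hm) ?_
  linear_combination h

end Formula

theorem statement8 (n p : ℕ) (hn : 4 ≤ n) (hp : p.Prime) :
    (degree n (Matrix.diagonal fun i : Fin n =>
      if i.val ≤ 1 then (p : ℚ) else if n - 2 ≤ i.val then (p : ℚ) ^ 3 else (p : ℚ) ^ 2) : ℚ) =
      (p : ℚ) ^ 4 * ((p : ℚ) ^ (n - 3) - 1) * ((p : ℚ) ^ (n - 2) - 1) * ((p : ℚ) ^ (n - 1) - 1)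
        * ((p : ℚ) ^ n - 1) / (((p : ℚ) - 1) ^ 2 * ((p : ℚ) ^ 2 - 1) ^ 2) := by
  obtain ⟨m, rfl⟩ := Nat.exists_eq_add_of_le' hn
  have : Fact p.Prime := ⟨hp⟩
  have hdiag : (Matrix.diagonal fun i : Fin (m + 4) =>
      if i.val ≤ 1 then (p : ℚ) else if m + 4 - 2 ≤ i.val then (p : ℚ) ^ 3 else (p : ℚ) ^ 2) =
      toQ (m + 4) (diagonal fun i => (p : ℤ) ^ (blockLabel (m + 4) i + 1)) := by
    rw [toQ, diagonal_map Int.cast_zero]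
    congr 1
    ext i
    simp only [blockLabel]
    split_ifs <;> simp
  have hle : intertwiner (diagonal fun i => (p : ℤ) ^ (blockLabel (m + 4) i + 1)) ≤
      (blockLower (ZMod p) (blockLabel (m + 4))).comap (reduction _ p) := fun γ hγ =>
    ((mem_intertwiner_iff_of_le_two hp.ne_zero (blockLabel_le_two _)).1 hγ).1
  rw [hdiag, degree_toQ, ← Subgroup.relIndex_mul_index hle,
    relIndex_intertwiner (blockLabel_le_two _), index_comap_reduction_blockLower,
    natCard_blockLabel_eq_zero, natCard_blockLabel_eq_two, Nat.cast_mul,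
    index_blockLower_blockLabel, Nat.cast_pow, mul_div_assoc', show m + 4 - 3 = m + 1 by lia,
    show m + 4 - 2 = m + 2 by lia, show m + 4 - 1 = m + 3 by lia]
  simp only [mul_assoc]
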